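/- The restriction of g to the open first quadrant Q := {z ∈ ℂ : Re z > 0 and Im z > 0} is a holomorphic bijection from Q onto the interior of the triangle with vertices 0, 1 and i√3. Moreover g maps the real interval (0,1) into (0,1), and for every real t > 0 the value g(it) is purely imaginary with 0 < Im g(it) < √3. -/

import Mathlib

open Complex Set Filter

/-- The Gauss hypergeometric function `₂F₁(p,q;r;z)` defined via the Euler integral
(principal branches of all complex powers). -/
noncomputable def hyp (p q r z : ℂ) : ℂ :=
  Complex.Gamma r / (Complex.Gamma q * Complex.Gamma (r - q)) *
    ∫ t in (0:ℝ)..1, (t : ℂ) ^ (q - 1) * (1 - (t : ℂ)) ^ (r - q - 1) * (1 - (t : ℂ) * z) ^ (-p)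

/-- The two slits `(-∞,-1] ∪ [1,+∞)` on the real axis, viewed inside `ℂ`. -/
def slit : Set ℂ := {z | z.im = 0 ∧ (z.re ≤ -1 ∨ 1 ≤ z.re)}

/-- The slit plane `D = ℂ ∖ ((-∞,-1] ∪ [1,+∞))`. -/
def Dslit : Set ℂ := slitᶜ

/-- `g(z) = (2√3·Γ(2/3)/(√π·Γ(1/6)))·z·₂F₁(1/2,2/3;3/2;z²)`. -/
noncomputable def g (z : ℂ) : ℂ :=
  2 * (Real.sqrt 3 : ℂ) * Complex.Gamma (2/3) /
      ((Real.sqrt Real.pi : ℂ) * Complex.Gamma (1/6)) *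
    z * hyp (1/2) (2/3) (3/2) (z ^ 2)

/-- The open first quadrant. -/
def Quad : Set ℂ := {z | 0 < z.re ∧ 0 < z.im}

open MeasureTheory Topology

/-- The kernel `t^(2/3-1) (1-t)^(5/6-1)` of the Beta integral `B(2/3, 5/6)`. -/
noncomputable def betaKernel (t : ℝ) : ℂ :=
  (t : ℂ) ^ ((2 / 3 : ℂ) - 1) * (1 - (t : ℂ)) ^ ((5 / 6 : ℂ) - 1)

/-- The Euler integral `∫₀¹ t^(2/3-1) (1-t)^(5/6-1) (1-tw)^(-p) dt`. -/
noncomputable def eulerInt (p w : ℂ) : ℂ :=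
  ∫ t in (0 : ℝ)..1, betaKernel t * (1 - (t : ℂ) * w) ^ (-p)

lemma intervalIntegrable_betaKernel : IntervalIntegrable betaKernel volume 0 1 :=
  betaIntegral_convergent (by norm_num) (by norm_num)

lemma one_sub_mul_mem_slitPlane {w : ℂ} (hw : 1 - w ∈ slitPlane) {t : ℝ}
    (ht : t ∈ Icc (0 : ℝ) 1) : 1 - (t : ℂ) * w ∈ slitPlane := by
  have h := starConvex_one_slitPlane hw (a := 1 - t) (b := t) (by linarith [ht.2]) ht.1 (by ring)
  convert h using 1
  simp only [real_smul]
  push_cast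
  ring

lemma continuousOn_one_sub_mul_cpow {w : ℂ} (hw : 1 - w ∈ slitPlane) (q : ℂ) :
    ContinuousOn (fun t : ℝ => (1 - (t : ℂ) * w) ^ q) (Icc 0 1) := by
  refine ContinuousOn.cpow_const (by fun_prop) fun t ht => one_sub_mul_mem_slitPlane hw ht

lemma intervalIntegrable_betaKernel_mul {f : ℝ → ℂ} (hf : ContinuousOn f (Icc 0 1)) :
    IntervalIntegrable (fun t => betaKernel t * f t) volume 0 1 :=
  intervalIntegrable_betaKernel.mul_continuousOn (by rwa [uIcc_of_le zero_le_one])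

lemma isOpen_one_sub_mem_slitPlane : IsOpen {w : ℂ | 1 - w ∈ slitPlane} :=
  isOpen_slitPlane.preimage (by fun_prop)

lemma hasDerivAt_eulerInt (p : ℂ) {w : ℂ} (hw : 1 - w ∈ slitPlane) :
    HasDerivAt (eulerInt p)
      (∫ t in (0 : ℝ)..1, betaKernel t * (p * t * (1 - (t : ℂ) * w) ^ (-p - 1))) w := by
  obtain ⟨ε, hε, hball⟩ := Metric.nhds_basis_closedBall.mem_iff.1
    (isOpen_one_sub_mem_slitPlane.mem_nhds hw)
  have hc : ContinuousOn (fun x : ℂ × ℝ => p * x.2 * (1 - (x.2 : ℂ) * x.1) ^ (-p - 1))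
      (Metric.closedBall w ε ×ˢ Icc (0 : ℝ) 1) :=
    ContinuousOn.mul (by fun_prop) (ContinuousOn.cpow_const (by fun_prop)
      fun x hx => one_sub_mul_mem_slitPlane (hball hx.1) hx.2)
  obtain ⟨C, hC⟩ := ((isCompact_closedBall w ε).prod isCompact_Icc).exists_bound_of_continuousOn hc
  have hI : uIoc (0 : ℝ) 1 ⊆ Icc 0 1 := by
    rw [uIoc_of_le zero_le_one]; exact Ioc_subset_Icc_self
  refine (intervalIntegral.hasDerivAt_integral_of_dominated_loc_of_deriv_le
    (F := fun x t => betaKernel t * (1 - (t : ℂ) * x) ^ (-p))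
    (F' := fun x t => betaKernel t * (p * t * (1 - (t : ℂ) * x) ^ (-p - 1)))
    (bound := fun t => ‖betaKernel t‖ * C) (Metric.closedBall_mem_nhds w hε)
    ?_ ?_ ?_ ?_ (intervalIntegrable_betaKernel.norm.mul_const C) ?_).2
  · filter_upwards [isOpen_one_sub_mem_slitPlane.mem_nhds hw] with x hx
    exact (intervalIntegrable_betaKernel_mul
      (continuousOn_one_sub_mul_cpow hx _)).aestronglyMeasurable_restrict_uIoc
  · exact intervalIntegrable_betaKernel_mul (continuousOn_one_sub_mul_cpow hw _)
  · exact (intervalIntegrable_betaKernel_mul (f := fun t => p * t * (1 - (t : ℂ) * w) ^ (-p - 1))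
      (ContinuousOn.mul (by fun_prop)
        (continuousOn_one_sub_mul_cpow hw _))).aestronglyMeasurable_restrict_uIoc
  · refine Eventually.of_forall fun t ht x hx => ?_
    rw [norm_mul]
    exact mul_le_mul_of_nonneg_left (hC (x, t) ⟨hx, hI ht⟩) (norm_nonneg _)
  · refine Eventually.of_forall fun t ht x hx => ?_
    have h1 : HasDerivAt (fun x : ℂ => 1 - (t : ℂ) * x) (-t) x := by
      simpa using ((hasDerivAt_id x).const_mul (t : ℂ)).const_sub 1
    refine ((h1.cpow_const (c := -p)
      (one_sub_mul_mem_slitPlane (hball hx) (hI ht))).const_mul (betaKernel t)).congr_deriv ?_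
    ring

lemma cpow_eq_mul_cpow_sub_one {x : ℂ} (hx : x ≠ 0) (a : ℂ) : x ^ a = x * x ^ (a - 1) := by
  rw [cpow_sub _ _ hx, cpow_one]
  field_simp

/-- `(1 - w) F' = 2/3 F` for `F = eulerInt (3/2)`. -/
lemma eulerInt_three_halves_ode {w : ℂ} (hw : 1 - w ∈ slitPlane) :
    (1 - w) * (∫ t in (0 : ℝ)..1,
      betaKernel t * ((3 / 2 : ℂ) * t * (1 - (t : ℂ) * w) ^ (-(3 / 2 : ℂ) - 1))) =
    2 / 3 * eulerInt (3 / 2) w := by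
  have hi1 : IntervalIntegrable (fun t : ℝ => betaKernel t * (1 - (t : ℂ) * w) ^ (-(3 / 2) : ℂ))
      volume 0 1 := intervalIntegrable_betaKernel_mul (continuousOn_one_sub_mul_cpow hw _)
  have hi2 : IntervalIntegrable (fun t : ℝ => betaKernel t *
      ((3 / 2 : ℂ) * t * (1 - (t : ℂ) * w) ^ (-(3 / 2 : ℂ) - 1))) volume 0 1 :=
    intervalIntegrable_betaKernel_mul (ContinuousOn.mul (by fun_prop)
      (continuousOn_one_sub_mul_cpow hw _))
  have key := intervalIntegral.integral_eq_sub_of_hasDerivAt_of_le (zero_le_one' ℝ)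
    (f := fun t : ℝ => (t : ℂ) ^ (2 / 3 : ℂ) * (1 - (t : ℂ)) ^ (5 / 6 : ℂ) *
      (1 - (t : ℂ) * w) ^ (-(3 / 2) : ℂ))
    (f' := fun t : ℝ => 2 / 3 * (betaKernel t * (1 - (t : ℂ) * w) ^ (-(3 / 2) : ℂ)) -
      (1 - w) * (betaKernel t * ((3 / 2 : ℂ) * t * (1 - (t : ℂ) * w) ^ (-(3 / 2 : ℂ) - 1))))
    ?_ ?_ ((hi1.const_mul _).sub (hi2.const_mul _))
  · rw [intervalIntegral.integral_sub (hi1.const_mul _) (hi2.const_mul _),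
      intervalIntegral.integral_const_mul, intervalIntegral.integral_const_mul] at key
    rw [eulerInt]
    norm_num at key
    rw [sub_eq_zero] at key
    rw [show (-(3 / 2) - 1 : ℂ) = -(5 / 2) by norm_num]
    exact key.symm
  · refine ContinuousOn.mul (Continuous.continuousOn ?_) (continuousOn_one_sub_mul_cpow hw _)
    refine Continuous.mul ?_ ?_
    · refine continuous_iff_continuousAt.2 fun t => ?_
      exact (continuousAt_ofReal_cpow_const t (2 / 3) (Or.inl (by norm_num)))
    · have h2 : Continuous fun t : ℝ => (t : ℂ) ^ (5 / 6 : ℂ) :=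
        continuous_iff_continuousAt.2 fun t =>
          (continuousAt_ofReal_cpow_const t (5 / 6) (Or.inl (by norm_num)))
      have h3 : Continuous fun t : ℝ => (1 : ℝ) - t := by fun_prop
      simpa [Function.comp_def] using h2.comp h3
  · intro t ht
    have hA : (t : ℂ) ∈ slitPlane := ofReal_mem_slitPlane.2 ht.1
    have hB : 1 - (t : ℂ) ∈ slitPlane := by
      have := ofReal_mem_slitPlane.2 (sub_pos.2 ht.2); simpa using this
    have hC := one_sub_mul_mem_slitPlane hw (Ioo_subset_Icc_self ht)
    have d1 := (((hasDerivAt_id (t : ℂ)).cpow_const (c := (2 / 3 : ℂ)) hA).mul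
      (((hasDerivAt_id (t : ℂ)).const_sub 1).cpow_const (c := (5 / 6 : ℂ)) hB)).mul
      ((((hasDerivAt_id (t : ℂ)).mul_const w).const_sub 1).cpow_const (c := (-(3 / 2) : ℂ)) hC)
    refine (d1.comp_ofReal).congr_deriv ?_
    simp only [id, betaKernel, Pi.mul_apply]
    rw [cpow_eq_mul_cpow_sub_one (slitPlane_ne_zero hA) (2 / 3),
      cpow_eq_mul_cpow_sub_one (slitPlane_ne_zero hB) (5 / 6),
      cpow_eq_mul_cpow_sub_one (slitPlane_ne_zero hC) (-(3 / 2))]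
    ring

lemma eulerInt_three_halves {w : ℂ} (hw : 1 - w ∈ slitPlane) :
    eulerInt (3 / 2) w = betaIntegral (2 / 3) (5 / 6) * (1 - w) ^ (-(2 / 3) : ℂ) := by
  have hS : IsPreconnected {w : ℂ | 1 - w ∈ slitPlane} := by
    refine (StarConvex.isPathConnected (a := (0 : ℂ)) ?_ (by simp)).isConnected.isPreconnected
    intro x hx a b ha hb hab
    have := starConvex_one_slitPlane hx ha hb hab
    simp only [mem_ofPred_eq, smul_zero, zero_add] at this ⊢
    convert this using 1
    simp only [real_smul]
    have : (a : ℂ) + b = 1 := by exact_mod_cast hab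
    linear_combination -this
  have hd : ∀ x ∈ {w : ℂ | 1 - w ∈ slitPlane},
      HasDerivAt (fun x => eulerInt (3 / 2) x * (1 - x) ^ (2 / 3 : ℂ)) 0 x := by
    intro x hx
    have h1 := (hasDerivAt_eulerInt (3 / 2) hx).mul
      (((hasDerivAt_id x).const_sub 1).cpow_const (c := (2 / 3 : ℂ)) hx)
    refine h1.congr_deriv ?_
    have h2 := eulerInt_three_halves_ode hx
    simp only [id]
    rw [cpow_eq_mul_cpow_sub_one (slitPlane_ne_zero hx) (2 / 3)]
    linear_combination (1 - x) ^ ((2 / 3 : ℂ) - 1) * h2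
  obtain ⟨a, ha⟩ := isOpen_one_sub_mem_slitPlane.exists_is_const_of_deriv_eq_zero hS
    (fun x hx => (hd x hx).differentiableAt.differentiableWithinAt)
    (fun x hx => (hd x hx).deriv)
  have h0 := ha 0 (by simp)
  have h1 := ha w hw
  have h2 : eulerInt (3 / 2) 0 = betaIntegral (2 / 3) (5 / 6) := by
    simp [eulerInt, betaIntegral, betaKernel]
  simp only [sub_zero, one_cpow, mul_one, h2] at h0
  have hne : (1 - w) ^ (2 / 3 : ℂ) ≠ 0 := by
    simp [cpow_eq_zero_iff, slitPlane_ne_zero hw]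
  rw [cpow_neg, h0, ← h1]
  field_simp

lemma Gamma_one_sixth_mul_Gamma_five_sixths :
    Complex.Gamma (1 / 6) * Complex.Gamma (5 / 6) = 2 * Real.pi := by
  have h := Complex.Gamma_mul_Gamma_one_sub (1 / 6)
  rw [show (1 - 1 / 6 : ℂ) = 5 / 6 by norm_num] at h
  have hs : Complex.sin (Real.pi * (1 / 6)) = 1 / 2 := by
    have := Real.sin_pi_div_six
    rw [show (Real.pi : ℂ) * (1 / 6) = ((Real.pi / 6 : ℝ) : ℂ) by push_cast; ring,
      ← ofReal_sin, this]
    norm_num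
  rw [h, hs]
  ring

lemma g_eq (z : ℂ) :
    g z = ((Real.sqrt 3 / (2 * Real.pi) : ℝ) : ℂ) * (z * eulerInt (1 / 2) (z ^ 2)) := by
  have hΓ : Complex.Gamma (3 / 2) = Real.sqrt Real.pi / 2 := by
    have h := Complex.Gamma_add_one (1 / 2) (by norm_num)
    rw [show (1 / 2 + 1 : ℂ) = 3 / 2 by norm_num, Complex.Gamma_one_half_eq] at h
    rw [h, Real.sqrt_eq_rpow, ofReal_cpow Real.pi_pos.le]
    push_cast
    ring
  have h1 : Complex.Gamma (2 / 3) ≠ 0 := Complex.Gamma_ne_zero_of_re_pos (by norm_num)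
  have h2 : Complex.Gamma (1 / 6) ≠ 0 := Complex.Gamma_ne_zero_of_re_pos (by norm_num)
  have h3 : Complex.Gamma (5 / 6) ≠ 0 := Complex.Gamma_ne_zero_of_re_pos (by norm_num)
  have hπ : (Real.pi : ℂ) ≠ 0 := ofReal_ne_zero.2 Real.pi_ne_zero
  have hπ' : (Real.sqrt Real.pi : ℂ) ≠ 0 :=
    ofReal_ne_zero.2 (Real.sqrt_ne_zero'.2 Real.pi_pos)
  have hint : (∫ t in (0 : ℝ)..1, (t : ℂ) ^ ((2 / 3 : ℂ) - 1) *
      (1 - (t : ℂ)) ^ ((3 / 2 : ℂ) - 2 / 3 - 1) * (1 - (t : ℂ) * z ^ 2) ^ (-(1 / 2) : ℂ)) =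
      eulerInt (1 / 2) (z ^ 2) := by
    rw [show ((3 / 2 : ℂ) - 2 / 3 - 1) = 5 / 6 - 1 by norm_num]
    rfl
  rw [g, hyp, hint, show ((3 / 2 : ℂ) - 2 / 3) = 5 / 6 by norm_num, hΓ]
  push_cast
  rw [← Gamma_one_sixth_mul_Gamma_five_sixths]
  field_simp

/-- The value of `g'` at `0`. -/
noncomputable def gDerivZero : ℝ :=
  Real.sqrt 3 / (2 * Real.pi) * (Real.Gamma (2 / 3) * Real.Gamma (5 / 6) / Real.Gamma (3 / 2))

lemma gDerivZero_pos : 0 < gDerivZero := by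
  have h1 : 0 < Real.Gamma (2 / 3) := Real.Gamma_pos_of_pos (by norm_num)
  have h2 : 0 < Real.Gamma (5 / 6) := Real.Gamma_pos_of_pos (by norm_num)
  have h3 : 0 < Real.Gamma (3 / 2) := Real.Gamma_pos_of_pos (by norm_num)
  have := Real.pi_pos
  unfold gDerivZero
  positivity

lemma ofReal_gDerivZero : (gDerivZero : ℂ) =
    ((Real.sqrt 3 / (2 * Real.pi) : ℝ) : ℂ) * betaIntegral (2 / 3) (5 / 6) := by
  have h := Complex.Gamma_mul_Gamma_eq_betaIntegral (s := 2 / 3) (t := 5 / 6)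
    (by norm_num) (by norm_num)
  rw [show (2 / 3 + 5 / 6 : ℂ) = 3 / 2 by norm_num] at h
  have h3 : Complex.Gamma (3 / 2) ≠ 0 := Complex.Gamma_ne_zero_of_re_pos (by norm_num)
  rw [gDerivZero, ofReal_mul]
  congr 1
  push_cast [← Complex.Gamma_ofReal]
  rw [h]
  field_simp

lemma hasDerivAt_g {z : ℂ} (hz : 1 - z ^ 2 ∈ slitPlane) :
    HasDerivAt g (gDerivZero * (1 - z ^ 2) ^ (-(2 / 3) : ℂ)) z := by
  have hfun : g = fun z => ((Real.sqrt 3 / (2 * Real.pi) : ℝ) : ℂ) *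
      (z * eulerInt (1 / 2) (z ^ 2)) := funext g_eq
  have h1 := ((hasDerivAt_id z).mul ((hasDerivAt_eulerInt (1 / 2) hz).comp z
    (hasDerivAt_pow 2 z))).const_mul ((Real.sqrt 3 / (2 * Real.pi) : ℝ) : ℂ)
  rw [hfun]
  refine h1.congr_deriv ?_
  rw [ofReal_gDerivZero, mul_assoc, ← eulerInt_three_halves hz]
  congr 1
  have hi1 : IntervalIntegrable (fun t : ℝ => betaKernel t * (1 - (t : ℂ) * z ^ 2) ^ (-(1 / 2) : ℂ))
      volume 0 1 := intervalIntegrable_betaKernel_mul (continuousOn_one_sub_mul_cpow hz _)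
  have hi2 : IntervalIntegrable (fun t : ℝ => betaKernel t *
      ((1 / 2 : ℂ) * t * (1 - (t : ℂ) * z ^ 2) ^ (-(1 / 2 : ℂ) - 1))) volume 0 1 :=
    intervalIntegrable_betaKernel_mul (ContinuousOn.mul (by fun_prop)
      (continuousOn_one_sub_mul_cpow hz _))
  simp only [id, one_mul, Function.comp_apply, eulerInt]
  have hJ : ∀ J : ℂ, z * (J * ((2 : ℕ) * z ^ (2 - 1))) = 2 * z ^ 2 * J := fun J => by
    push_cast
    ring
  rw [hJ, ← intervalIntegral.integral_const_mul,
    ← intervalIntegral.integral_add hi1 (hi2.const_mul _)]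
  refine intervalIntegral.integral_congr fun t ht => ?_
  rw [uIcc_of_le zero_le_one] at ht
  have hne := slitPlane_ne_zero (one_sub_mul_mem_slitPlane hz ht)
  rw [cpow_eq_mul_cpow_sub_one hne (-(1 / 2)), show (-(1 / 2) - 1 : ℂ) = -(3 / 2) by norm_num]
  ring

lemma betaKernel_eq_ofReal {t : ℝ} (ht : t ∈ Ioo (0 : ℝ) 1) :
    betaKernel t = ((t ^ ((2 / 3 : ℝ) - 1) * (1 - t) ^ ((5 / 6 : ℝ) - 1) : ℝ) : ℂ) := by
  rw [betaKernel, ofReal_mul, ofReal_cpow ht.1.le, ofReal_cpow (sub_nonneg.2 ht.2.le)]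
  push_cast
  rfl

lemma map_g_nonneg (ℓ : ℂ →L[ℝ] ℝ) {z : ℂ} (hz : 1 - z ^ 2 ∈ slitPlane)
    (h : ∀ t ∈ Ioo (0 : ℝ) 1, 0 ≤ ℓ (z * (1 - (t : ℂ) * z ^ 2) ^ (-(1 / 2) : ℂ))) :
    0 ≤ ℓ (g z) := by
  have hi1 : IntervalIntegrable (fun t : ℝ => betaKernel t * (1 - (t : ℂ) * z ^ 2) ^ (-(1 / 2) : ℂ))
      volume 0 1 := intervalIntegrable_betaKernel_mul (continuousOn_one_sub_mul_cpow hz _)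
  rw [g_eq, ← real_smul, map_smul, smul_eq_mul, eulerInt,
    ← intervalIntegral.integral_const_mul, ← ℓ.intervalIntegral_comp_comm (hi1.const_mul z),
    intervalIntegral.integral_of_le zero_le_one, integral_Ioc_eq_integral_Ioo]
  refine mul_nonneg (by have := Real.pi_pos; positivity) ?_
  refine setIntegral_nonneg measurableSet_Ioo fun t ht => ?_
  rw [betaKernel_eq_ofReal ht, mul_left_comm, ← real_smul, map_smul, smul_eq_mul]
  have h1 := Real.rpow_nonneg ht.1.le ((2 / 3 : ℝ) - 1)
  have h2 := Real.rpow_nonneg (sub_nonneg.2 ht.2.le) ((5 / 6 : ℝ) - 1)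
  exact mul_nonneg (mul_nonneg h1 h2) (h t ht)

lemma one_sub_sq_im (z : ℂ) : (1 - z ^ 2).im = -(2 * z.re * z.im) := by
  simp [pow_two]; ring

lemma one_sub_sq_mem_slitPlane {z : ℂ} (hz : z ∈ Quad) : 1 - z ^ 2 ∈ slitPlane := by
  refine mem_slitPlane_iff.2 (Or.inr ?_)
  rw [one_sub_sq_im]
  have := mul_pos hz.1 hz.2
  linarith

lemma one_sub_ofReal_sq_mem_slitPlane {x : ℝ} (hx : x ∈ Ioo (-1 : ℝ) 1) :
    1 - (x : ℂ) ^ 2 ∈ slitPlane := by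
  have h : 0 < 1 - x ^ 2 := by nlinarith [hx.1, hx.2]
  simpa using ofReal_mem_slitPlane.2 h

lemma one_sub_I_mul_sq (t : ℝ) : 1 - (I * t) ^ 2 = ((1 + t ^ 2 : ℝ) : ℂ) := by
  push_cast
  rw [mul_pow, I_sq]
  ring

lemma one_sub_I_mul_sq_mem_slitPlane (t : ℝ) : 1 - (I * t) ^ 2 ∈ slitPlane := by
  rw [one_sub_I_mul_sq]
  exact ofReal_mem_slitPlane.2 (by positivity)

lemma cpow_neg_half_sq {w : ℂ} (hw : w ≠ 0) : (w ^ (-(1 / 2) : ℂ)) ^ 2 = w⁻¹ := by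
  rw [pow_two, ← cpow_add _ _ hw, show (-(1 / 2) + -(1 / 2) : ℂ) = -1 by norm_num, cpow_neg_one]

lemma kernel_mem_Quad {z : ℂ} (hz : z ∈ Quad) {t : ℝ} (ht : 0 < t) :
    z * (1 - (t : ℂ) * z ^ 2) ^ (-(1 / 2) : ℂ) ∈ Quad := by
  have hx := hz.1
  have hy := hz.2
  set w : ℂ := 1 - (t : ℂ) * z ^ 2 with hw
  have hre : w.re = 1 - t * (z ^ 2).re := by simp [hw]
  have him : w.im = -(t * (z ^ 2).im) := by simp [hw]
  have hz2 : 0 < (z ^ 2).im := by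
    have : (z ^ 2).im = 2 * (z.re * z.im) := by simp [pow_two]; ring
    rw [this]; positivity
  have hwim : w.im < 0 := by rw [him]; nlinarith [mul_pos ht hz2]
  have hw0 : w ≠ 0 := fun h => by simp [h] at hwim
  have harg : arg w < 0 := arg_neg_iff.2 hwim
  have harg' := neg_pi_lt_arg w
  have hr : 0 < ‖w‖ ^ (-(1 / 2) : ℝ) := Real.rpow_pos_of_pos (norm_pos_iff.2 hw0) _
  have hcast : (-(1 / 2) : ℂ) = ((-(1 / 2) : ℝ) : ℂ) := by push_cast; rfl
  have hvre : 0 < (w ^ (-(1 / 2) : ℂ)).re := by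
    rw [hcast, cpow_ofReal_re]
    exact mul_pos hr (Real.cos_pos_of_mem_Ioo ⟨by linarith, by linarith⟩)
  have hvim : 0 < (w ^ (-(1 / 2) : ℂ)).im := by
    rw [hcast, cpow_ofReal_im]
    exact mul_pos hr (Real.sin_pos_of_pos_of_lt_pi (by linarith) (by linarith))
  have hsim : 0 < (z * w ^ (-(1 / 2) : ℂ)).im := by
    rw [mul_im]; positivity
  refine ⟨?_, hsim⟩
  have hsq : (z * w ^ (-(1 / 2) : ℂ)) ^ 2 = z ^ 2 / w := by
    rw [mul_pow, cpow_neg_half_sq hw0, div_eq_mul_inv]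
  have hsq' : 0 < ((z * w ^ (-(1 / 2) : ℂ)) ^ 2).im := by
    have hn : 0 < normSq w := normSq_pos.2 hw0
    rw [hsq, div_im, ← sub_div, hre, him]
    apply div_pos _ hn
    nlinarith
  have h2 : ((z * w ^ (-(1 / 2) : ℂ)) ^ 2).im =
      2 * (z * w ^ (-(1 / 2) : ℂ)).re * (z * w ^ (-(1 / 2) : ℂ)).im := by
    rw [pow_two, mul_im (z * _)]; ring
  rw [h2] at hsq'
  by_contra! hcon
  nlinarith [mul_nonneg (neg_nonneg.2 hcon) hsim.le]

lemma g_re_nonneg {z : ℂ} (hz : z ∈ Quad) : 0 ≤ (g z).re :=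
  map_g_nonneg reCLM (one_sub_sq_mem_slitPlane hz) fun _ ht => (kernel_mem_Quad hz ht.1).1.le

lemma g_im_nonneg {z : ℂ} (hz : z ∈ Quad) : 0 ≤ (g z).im :=
  map_g_nonneg imCLM (one_sub_sq_mem_slitPlane hz) fun _ ht => (kernel_mem_Quad hz ht.1).2.le

lemma map_g_eq_zero (ℓ : ℂ →L[ℝ] ℝ) {z : ℂ} (hz : 1 - z ^ 2 ∈ slitPlane)
    (h : ∀ t ∈ Ioo (0 : ℝ) 1, ℓ (z * (1 - (t : ℂ) * z ^ 2) ^ (-(1 / 2) : ℂ)) = 0) :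
    ℓ (g z) = 0 := by
  have h1 := map_g_nonneg ℓ hz fun t ht => (h t ht).ge
  have h2 := map_g_nonneg (-ℓ) hz fun t ht => by
    rw [neg_apply, h t ht, neg_zero]
  rw [neg_apply] at h2
  linarith

lemma g_ofReal_im {x : ℝ} (hx : x ∈ Ioo (-1 : ℝ) 1) : (g x).im = 0 := by
  refine map_g_eq_zero imCLM (one_sub_ofReal_sq_mem_slitPlane hx) fun t ht => ?_
  have h : 0 ≤ 1 - t * x ^ 2 := by
    have : x ^ 2 < 1 := by nlinarith [hx.1, hx.2]
    nlinarith [ht.1, ht.2, sq_nonneg x]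
  have h2 : (x : ℂ) * (1 - (t : ℂ) * (x : ℂ) ^ 2) ^ (-(1 / 2) : ℂ) =
      ((x * (1 - t * x ^ 2) ^ (-(1 / 2) : ℝ) : ℝ) : ℂ) := by
    rw [ofReal_mul, ofReal_cpow h]
    push_cast
    rfl
  rw [h2, imCLM_apply, ofReal_im]

lemma g_I_mul_re (t : ℝ) : (g (I * t)).re = 0 := by
  refine map_g_eq_zero reCLM (one_sub_I_mul_sq_mem_slitPlane t) fun s hs => ?_
  have h : 0 ≤ 1 + s * t ^ 2 := by have := hs.1; positivity
  have h2 : (I * t) * (1 - (s : ℂ) * (I * t) ^ 2) ^ (-(1 / 2) : ℂ) =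
      I * ((t * (1 + s * t ^ 2) ^ (-(1 / 2) : ℝ) : ℝ) : ℂ) := by
    rw [ofReal_mul, ofReal_cpow h, mul_pow, I_sq]
    push_cast
    ring_nf
  rw [h2, reCLM_apply, re_mul_ofReal, I_re, zero_mul]

lemma g_zero : g 0 = 0 := by simp [g]

lemma neg_two_thirds_eq_ofReal : (-(2 / 3) : ℂ) = ((-(2 / 3) : ℝ) : ℂ) := by
  push_cast; rfl

lemma ofReal_cpow_re_pos {x : ℝ} (hx : 0 < x) :
    0 < ((gDerivZero : ℂ) * (x : ℂ) ^ (-(2 / 3) : ℂ)).re := by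
  rw [neg_two_thirds_eq_ofReal, ← ofReal_cpow hx.le, ← ofReal_mul, ofReal_re]
  exact mul_pos gDerivZero_pos (Real.rpow_pos_of_pos hx _)

lemma strictMonoOn_g_ofReal_re : StrictMonoOn (fun x : ℝ => (g x).re) (Ioo (-1) 1) := by
  have hd : ∀ x ∈ Ioo (-1 : ℝ) 1, HasDerivAt (fun x : ℝ => (g x).re)
      ((gDerivZero : ℂ) * (1 - (x : ℂ) ^ 2) ^ (-(2 / 3) : ℂ)).re x := fun x hx =>
    (hasDerivAt_g (one_sub_ofReal_sq_mem_slitPlane hx)).real_of_complex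
  refine strictMonoOn_of_deriv_pos (convex_Ioo _ _)
    (fun x hx => (hd x hx).continuousAt.continuousWithinAt) fun x hx => ?_
  rw [interior_Ioo] at hx
  rw [(hd x hx).deriv]
  have h : 0 < 1 - x ^ 2 := by nlinarith [hx.1, hx.2]
  simpa using ofReal_cpow_re_pos h

lemma strictMono_g_I_mul_im : StrictMono fun t : ℝ => (g (I * t)).im := by
  refine strictMono_of_hasDerivAt_pos (f' := fun t =>
    ((gDerivZero : ℂ) * (1 - (I * t) ^ 2) ^ (-(2 / 3) : ℂ)).re) (fun t => ?_) fun t => ?_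
  · have h1 := (((hasDerivAt_g (one_sub_I_mul_sq_mem_slitPlane t)).comp (t : ℂ)
      ((hasDerivAt_id (t : ℂ)).const_mul I)).const_mul (-I)).real_of_complex
    have h2 : (fun t : ℝ => (g (I * t)).im) =
        fun x : ℝ => (-I * (g ∘ fun y => I * id y) (x : ℂ)).re := by
      funext x; simp
    rw [h2]
    refine h1.congr_deriv ?_
    congr 1
    linear_combination (-(gDerivZero : ℂ) * (1 - (I * t) ^ 2) ^ (-(2 / 3) : ℂ)) * I_sq
  · rw [one_sub_I_mul_sq]
    exact ofReal_cpow_re_pos (by positivity)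

lemma one_sub_sq_im_neg {z : ℂ} (hz : z ∈ Quad) : (1 - z ^ 2).im < 0 := by
  rw [one_sub_sq_im]
  have := mul_pos hz.1 hz.2
  linarith

lemma cpow_re_add_im_pos {w : ℂ} (hw : w.im < 0) :
    0 < (w ^ (-(2 / 3) : ℂ)).re + Real.sqrt 3 * (w ^ (-(2 / 3) : ℂ)).im := by
  have hw0 : w ≠ 0 := fun h => by simp [h] at hw
  rw [neg_two_thirds_eq_ofReal, cpow_ofReal_re, cpow_ofReal_im]
  have h1 : arg w < 0 := arg_neg_iff.2 hw
  have h2 := neg_pi_lt_arg w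
  have hr : 0 < ‖w‖ ^ (-(2 / 3) : ℝ) := Real.rpow_pos_of_pos (norm_pos_iff.2 hw0) _
  have hc : 0 < Real.cos (arg w * -(2 / 3) - Real.pi / 3) :=
    Real.cos_pos_of_mem_Ioo ⟨by linarith, by linarith⟩
  rw [Real.cos_sub, Real.cos_pi_div_three, Real.sin_pi_div_three] at hc
  nlinarith [mul_pos hr hc]

lemma sqrt_three_mul_cpow_re_add_im {w : ℂ} (hw : w.im < 0) :
    Real.sqrt 3 * (w ^ (-(2 / 3) : ℂ)).re + (w ^ (-(2 / 3) : ℂ)).im =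
      2 * (‖-w‖ ^ (-(2 / 3) : ℝ) * Real.sin (2 / 3 * arg (-w))) := by
  have h : Real.sin (2 / 3 * arg (-w)) = Real.cos (arg w * -(2 / 3) - Real.pi / 6) := by
    rw [arg_neg_eq_arg_add_pi_of_im_neg hw, ← Real.cos_pi_div_two_sub]
    congr 1
    ring
  rw [neg_two_thirds_eq_ofReal, cpow_ofReal_re, cpow_ofReal_im, h, norm_neg, Real.cos_sub,
    Real.cos_pi_div_six, Real.sin_pi_div_six]
  ring

lemma convex_Quad : Convex ℝ Quad :=
  (convex_halfSpace_re_gt 0).inter (convex_halfSpace_im_gt 0)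

lemma isOpen_Quad : IsOpen Quad :=
  (isOpen_lt continuous_const continuous_re).inter (isOpen_lt continuous_const continuous_im)

lemma injOn_g_Quad : InjOn g Quad := by
  intro a ha b hb hab
  by_contra hne
  have hba : b - a ≠ 0 := sub_ne_zero.2 (Ne.symm hne)
  have hmem : ∀ s ∈ Icc (0 : ℝ) 1, a + (s : ℂ) * (b - a) ∈ Quad := fun s hs => by
    have := convex_Quad.add_smul_sub_mem ha hb hs
    simpa using this
  set e : ℂ → ℂ := fun s => (1 - Real.sqrt 3 * I) / (b - a) * g (a + s * (b - a)) with he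
  have hd : ∀ s ∈ Icc (0 : ℝ) 1, HasDerivAt (fun s : ℝ => (e s).re)
      ((1 - Real.sqrt 3 * I) * (gDerivZero *
        (1 - (a + (s : ℂ) * (b - a)) ^ 2) ^ (-(2 / 3) : ℂ))).re s := fun s hs => by
    have h1 := ((hasDerivAt_g (one_sub_sq_mem_slitPlane (hmem s hs))).comp (s : ℂ)
      (((hasDerivAt_id (s : ℂ)).mul_const (b - a)).const_add a)).const_mul
        ((1 - Real.sqrt 3 * I) / (b - a))
    refine (h1.congr_deriv ?_).real_of_complex
    field_simp
  have hmono : StrictMonoOn (fun s : ℝ => (e s).re) (Icc 0 1) := by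
    refine strictMonoOn_of_deriv_pos (convex_Icc _ _)
      (fun s hs => (hd s hs).continuousAt.continuousWithinAt) fun s hs => ?_
    have hs := interior_subset hs
    rw [(hd s hs).deriv]
    have h2 := mul_pos gDerivZero_pos (cpow_re_add_im_pos (one_sub_sq_im_neg (hmem s hs)))
    simp only [mul_re, sub_re, one_re, ofReal_re, I_re, mul_zero, ofReal_im, I_im, mul_one,
      sub_im, one_im, mul_im, zero_mul, add_zero, sub_zero, zero_sub]
    nlinarith
  have h3 := hmono (left_mem_Icc.2 zero_le_one) (right_mem_Icc.2 zero_le_one) zero_lt_one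
  simp [he, hab] at h3

lemma isOpen_image_g_Quad : IsOpen (g '' Quad) := by
  rw [isOpen_iff_mem_nhds]
  rintro _ ⟨z, hz, rfl⟩
  have hdiff : DifferentiableOn ℂ g Quad := fun x hx =>
    (hasDerivAt_g (one_sub_sq_mem_slitPlane hx)).differentiableAt.differentiableWithinAt
  have hs := (hdiff.analyticAt (isOpen_Quad.mem_nhds hz)).hasStrictDerivAt
  have hne : deriv g z ≠ 0 := by
    rw [(hasDerivAt_g (one_sub_sq_mem_slitPlane hz)).deriv]
    refine mul_ne_zero (ofReal_ne_zero.2 gDerivZero_pos.ne') ?_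
    simp [cpow_eq_zero_iff, slitPlane_ne_zero (one_sub_sq_mem_slitPlane hz)]
  rw [← hs.map_nhds_eq hne]
  exact image_mem_map (isOpen_Quad.mem_nhds hz)

lemma kernel_eq {z : ℂ} (hz : z ∈ Quad) {t : ℝ} (ht : 0 < t) :
    z * (1 - (t : ℂ) * z ^ 2) ^ (-(1 / 2) : ℂ) = I * ((t : ℂ) - (z ^ 2)⁻¹) ^ (-(1 / 2) : ℂ) := by
  have hs := kernel_mem_Quad hz ht
  have hz0 : z ≠ 0 := fun h => by simpa [h] using hz.1
  have hz2 : 0 < (z ^ 2).im := by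
    have h := one_sub_sq_im_neg hz
    simpa using h
  set w : ℂ := (t : ℂ) - (z ^ 2)⁻¹ with hw
  have hwim : 0 < w.im := by
    have : 0 < normSq (z ^ 2) := normSq_pos.2 (pow_ne_zero 2 hz0)
    rw [hw, sub_im, ofReal_im, inv_im]
    have := div_pos hz2 this
    rw [neg_div]
    linarith
  have hw0 : w ≠ 0 := fun h => by simp [h] at hwim
  have hv0 : 1 - (t : ℂ) * z ^ 2 ≠ 0 := fun h => by
    have h1 := congrArg im h
    simp only [sub_im, one_im, im_ofReal_mul, zero_sub, zero_im] at h1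
    nlinarith [mul_pos ht hz2]
  have hre : 0 < (w ^ (-(1 / 2) : ℂ)).re := by
    have hcast : (-(1 / 2) : ℂ) = ((-(1 / 2) : ℝ) : ℂ) := by push_cast; rfl
    have h1 : 0 ≤ arg w := arg_nonneg_iff.2 hwim.le
    have h2 : arg w < Real.pi := arg_lt_pi_iff.2 (Or.inr hwim.ne')
    rw [hcast, cpow_ofReal_re]
    exact mul_pos (Real.rpow_pos_of_pos (norm_pos_iff.2 hw0) _)
      (Real.cos_pos_of_mem_Ioo ⟨by linarith, by linarith⟩)
  have hsq : (z * (1 - (t : ℂ) * z ^ 2) ^ (-(1 / 2) : ℂ)) ^ 2 =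
      (I * w ^ (-(1 / 2) : ℂ)) ^ 2 := by
    rw [mul_pow, mul_pow, cpow_neg_half_sq hv0, cpow_neg_half_sq hw0, I_sq]
    have h1 : w * z ^ 2 = -(1 - (t : ℂ) * z ^ 2) := by
      rw [hw]; field_simp; ring
    rw [eq_comm, ← div_eq_mul_inv, ← div_eq_mul_inv, div_eq_div_iff hw0 hv0]
    linear_combination -h1
  rcases sq_eq_sq_iff_eq_or_eq_neg.1 hsq with h | h
  · exact h
  · have h1 := hs.2
    rw [h] at h1
    simp at h1
    simp at hre
    linarith

lemma betaKernel_mul_cpow {t : ℝ} (ht : 0 < t) :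
    betaKernel t * (t : ℂ) ^ (-(1 / 2) : ℂ) =
      (t : ℂ) ^ ((1 / 6 : ℂ) - 1) * (1 - (t : ℂ)) ^ ((5 / 6 : ℂ) - 1) := by
  rw [betaKernel, mul_right_comm, ← cpow_add _ _ (ofReal_ne_zero.2 ht.ne')]
  norm_num

lemma mul_one_add_I_mem_Quad {M : ℝ} (hM : 0 < M) : (M : ℂ) * (1 + I) ∈ Quad := by
  simp [Quad, hM]

lemma tendsto_g_diagonal :
    Tendsto (fun M : ℝ => g (M * (1 + I))) atTop (𝓝 (I * Real.sqrt 3)) := by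
  have hconv := betaIntegral_convergent (u := 1 / 6) (v := 5 / 6) (by norm_num) (by norm_num)
  have hlim : Tendsto (fun M : ℝ => ((((M : ℂ) * (1 + I)) ^ 2)⁻¹)) atTop (𝓝 0) := by
    have h1 : Tendsto (fun M : ℝ => ((M⁻¹ : ℝ) : ℂ) ^ 2 * ((1 + I) ^ 2)⁻¹) atTop
        (𝓝 (((0 : ℝ) : ℂ) ^ 2 * ((1 + I) ^ 2)⁻¹)) :=
      (((continuous_ofReal.tendsto _).comp tendsto_inv_atTop_zero).pow 2).mul_const _
    simp only [ofReal_zero, ne_eq, OfNat.ofNat_ne_zero, not_false_eq_true, zero_pow,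
      zero_mul] at h1
    refine h1.congr fun M => ?_
    push_cast
    rw [mul_pow, mul_inv, inv_pow]
  have hint : Tendsto (fun M : ℝ => ∫ t in (0 : ℝ)..1, betaKernel t * (((M : ℂ) * (1 + I)) *
      (1 - (t : ℂ) * ((M : ℂ) * (1 + I)) ^ 2) ^ (-(1 / 2) : ℂ))) atTop
      (𝓝 (∫ t in (0 : ℝ)..1, I * ((t : ℂ) ^ ((1 / 6 : ℂ) - 1) *
        (1 - (t : ℂ)) ^ ((5 / 6 : ℂ) - 1)))) := by
    refine intervalIntegral.tendsto_integral_filter_of_dominated_convergence _ ?_ ?_ hconv.norm ?_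
    · filter_upwards [eventually_gt_atTop 0] with M hM
      exact (intervalIntegrable_betaKernel_mul (ContinuousOn.mul (f := fun _ => (M : ℂ) * (1 + I))
        continuousOn_const (continuousOn_one_sub_mul_cpow (one_sub_sq_mem_slitPlane
        (mul_one_add_I_mem_Quad hM)) _))).aestronglyMeasurable_restrict_uIoc
    · filter_upwards [eventually_gt_atTop 0] with M hM
      refine Eventually.of_forall fun t ht => ?_
      rw [uIoc_of_le zero_le_one] at ht
      rw [kernel_eq (mul_one_add_I_mem_Quad hM) ht.1, ← betaKernel_mul_cpow ht.1, norm_mul,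
        norm_mul, norm_mul, norm_I, one_mul]
      refine mul_le_mul_of_nonneg_left ?_ (norm_nonneg _)
      have hcast : (-(1 / 2) : ℂ) = ((-(1 / 2) : ℝ) : ℂ) := by push_cast; rfl
      rw [hcast, norm_cpow_real, norm_cpow_real, norm_real, Real.norm_of_nonneg ht.1.le]
      refine Real.rpow_le_rpow_of_nonpos ht.1 ?_ (by norm_num)
      refine le_trans (le_of_eq ?_) (re_le_norm _)
      have h3 : ((M : ℂ) * (1 + I)) ^ 2 = ((2 * M ^ 2 : ℝ) : ℂ) * I := by
        push_cast
        linear_combination (M : ℂ) ^ 2 * I_sq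
      rw [h3, sub_re, ofReal_re, inv_re, re_ofReal_mul, I_re, mul_zero, zero_div, sub_zero]
    · refine Eventually.of_forall fun t ht => ?_
      rw [uIoc_of_le zero_le_one] at ht
      rw [← betaKernel_mul_cpow ht.1]
      have h4 : Tendsto (fun M : ℝ => betaKernel t *
          (I * ((t : ℂ) - (((M : ℂ) * (1 + I)) ^ 2)⁻¹) ^ (-(1 / 2) : ℂ))) atTop
          (𝓝 (betaKernel t * (I * ((t : ℂ) - 0) ^ (-(1 / 2) : ℂ)))) :=
        (((tendsto_const_nhds.sub hlim).cpow tendsto_const_nhds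
          (by simpa using ht.1)).const_mul I).const_mul _
      rw [sub_zero, mul_left_comm] at h4
      refine h4.congr' ?_
      filter_upwards [eventually_gt_atTop 0] with M hM
      rw [kernel_eq (mul_one_add_I_mem_Quad hM) ht.1]
  have hval : ((Real.sqrt 3 / (2 * Real.pi) : ℝ) : ℂ) * (∫ t in (0 : ℝ)..1,
      I * ((t : ℂ) ^ ((1 / 6 : ℂ) - 1) * (1 - (t : ℂ)) ^ ((5 / 6 : ℂ) - 1))) =
      I * Real.sqrt 3 := by
    have hB := Complex.Gamma_mul_Gamma_eq_betaIntegral (s := 1 / 6) (t := 5 / 6)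
      (by norm_num) (by norm_num)
    rw [show (1 / 6 + 5 / 6 : ℂ) = 1 by norm_num, Complex.Gamma_one, one_mul,
      Gamma_one_sixth_mul_Gamma_five_sixths] at hB
    have hπ : (Real.pi : ℂ) ≠ 0 := ofReal_ne_zero.2 Real.pi_ne_zero
    rw [intervalIntegral.integral_const_mul, ← betaIntegral, ← hB]
    push_cast
    field_simp
  rw [← hval]
  refine (hint.const_mul _).congr fun M => ?_
  rw [g_eq, eulerInt, ← intervalIntegral.integral_const_mul ((M : ℂ) * (1 + I))]
  congr 1
  refine intervalIntegral.integral_congr fun t _ => ?_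
  ring

lemma norm_deriv_g_le {z : ℂ} {M : ℝ} (hM : 1 < M) (hz : M ≤ ‖z‖) :
    ‖(gDerivZero : ℂ) * (1 - z ^ 2) ^ (-(2 / 3) : ℂ)‖ ≤
      gDerivZero * (M ^ 2 - 1) ^ (-(2 / 3) : ℝ) := by
  rw [norm_mul, norm_real, Real.norm_of_nonneg gDerivZero_pos.le, neg_two_thirds_eq_ofReal,
    norm_cpow_real]
  refine mul_le_mul_of_nonneg_left ?_ gDerivZero_pos.le
  refine Real.rpow_le_rpow_of_nonpos (by nlinarith) ?_ (by norm_num)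
  have h1 := norm_sub_norm_le (z ^ 2) 1
  rw [norm_pow, norm_one, norm_sub_rev] at h1
  nlinarith

lemma norm_g_sub_diagonal_le {z : ℂ} (hz : z ∈ Quad) (hM : 1 < max z.re z.im) :
    ‖g z - g ((max z.re z.im : ℝ) * (1 + I))‖ ≤
      gDerivZero * (max z.re z.im ^ 2 - 1) ^ (-(2 / 3) : ℝ) * max z.re z.im := by
  set M := max z.re z.im with hMdef
  have hMpos : 0 < M := by linarith
  have hre : ((M : ℂ) * (1 + I)).re = M := by simp
  have him : ((M : ℂ) * (1 + I)).im = M := by simp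
  have key : ∀ s : Set ℂ, Convex ℝ s → s ⊆ Quad → (∀ w ∈ s, M ≤ ‖w‖) → z ∈ s →
      (M : ℂ) * (1 + I) ∈ s → ‖z - (M : ℂ) * (1 + I)‖ ≤ M →
      ‖g z - g ((M : ℝ) * (1 + I))‖ ≤ gDerivZero * (M ^ 2 - 1) ^ (-(2 / 3) : ℝ) * M := by
    intro s hs hsQ hsM hzs hMs hdist
    refine (hs.norm_image_sub_le_of_norm_hasDerivWithin_le
      (fun w hw => (hasDerivAt_g (one_sub_sq_mem_slitPlane (hsQ hw))).hasDerivWithinAt)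
      (fun w hw => norm_deriv_g_le hM (hsM w hw)) hMs hzs).trans ?_
    refine mul_le_mul_of_nonneg_left hdist (mul_nonneg gDerivZero_pos.le ?_)
    exact Real.rpow_nonneg (by nlinarith) _
  rcases le_total z.im z.re with h | h
  · have hMz : M = z.re := max_eq_left h
    refine key ({w | M ≤ w.re} ∩ {w | 0 < w.im})
      ((convex_halfSpace_re_ge M).inter (convex_halfSpace_im_gt 0))
      (fun w hw => ⟨hMpos.trans_le hw.1, hw.2⟩) (fun w hw => le_trans hw.1 (re_le_norm w))
      ⟨hMz.le, hz.2⟩ ⟨hre.ge, by simpa using hMpos⟩ ?_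
    refine (norm_le_abs_re_add_abs_im _).trans ?_
    rw [sub_re, sub_im, hre, him, hMz, sub_self, abs_zero, zero_add, abs_sub_comm,
      abs_of_nonneg (by linarith)]
    linarith [hz.2]
  · have hMz : M = z.im := max_eq_right h
    refine key ({w | 0 < w.re} ∩ {w | M ≤ w.im})
      ((convex_halfSpace_re_gt 0).inter (convex_halfSpace_im_ge M))
      (fun w hw => ⟨hw.1, hMpos.trans_le hw.2⟩)
      (fun w hw => le_trans hw.2 (im_le_norm w))
      ⟨hz.1, hMz.le⟩ ⟨by simpa using hMpos, him.ge⟩ ?_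
    refine (norm_le_abs_re_add_abs_im _).trans ?_
    rw [sub_re, sub_im, hre, him, hMz, sub_self, abs_zero, add_zero, abs_sub_comm,
      abs_of_nonneg (by linarith)]
    linarith [hz.1]

lemma tendsto_g_cobounded :
    Tendsto g (Bornology.cobounded ℂ ⊓ 𝓟 Quad) (𝓝 (I * Real.sqrt 3)) := by
  have hM : Tendsto (fun z : ℂ => max z.re z.im) (Bornology.cobounded ℂ ⊓ 𝓟 Quad) atTop := by
    have h1 : Tendsto (fun z : ℂ => ‖z‖ / 2) (Bornology.cobounded ℂ ⊓ 𝓟 Quad) atTop :=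
      (tendsto_norm_cobounded_atTop.mono_left inf_le_left).atTop_div_const two_pos
    refine tendsto_atTop_mono' _ ?_ h1
    filter_upwards [mem_inf_of_right (mem_principal_self Quad)] with z hz
    have h2 := norm_le_abs_re_add_abs_im z
    rw [abs_of_pos hz.1, abs_of_pos hz.2] at h2
    linarith [le_max_left z.re z.im, le_max_right z.re z.im]
  have hdecay : Tendsto (fun M : ℝ => gDerivZero * (M ^ 2 - 1) ^ (-(2 / 3) : ℝ) * M)
      atTop (𝓝 0) := by
    have hu : Tendsto (fun M : ℝ => M ^ 2 - 1) atTop atTop :=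
      tendsto_atTop_add_const_right _ (-1) (tendsto_pow_atTop two_ne_zero)
    have h1 := ((tendsto_rpow_neg_atTop (show (0 : ℝ) < 1 / 6 by norm_num)).comp hu).const_mul
      (2 * gDerivZero)
    rw [mul_zero] at h1
    refine squeeze_zero' ?_ ?_ h1
    · filter_upwards [eventually_ge_atTop 2] with M hM
      have : 0 ≤ (M ^ 2 - 1) ^ (-(2 / 3) : ℝ) := Real.rpow_nonneg (by nlinarith) _
      have := gDerivZero_pos
      positivity
    · filter_upwards [eventually_ge_atTop 2] with M hM
      have hu0 : 0 < M ^ 2 - 1 := by nlinarith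
      have h2 : M ≤ 2 * (M ^ 2 - 1) ^ (1 / 2 : ℝ) := by
        rw [← Real.sqrt_eq_rpow]
        refine abs_le_of_sq_le_sq' ?_ (by positivity) |>.2
        rw [mul_pow, Real.sq_sqrt hu0.le]
        nlinarith
      have h3 : (M ^ 2 - 1) ^ (-(1 / 6) : ℝ) =
          (M ^ 2 - 1) ^ (-(2 / 3) : ℝ) * (M ^ 2 - 1) ^ (1 / 2 : ℝ) := by
        rw [← Real.rpow_add hu0]; norm_num
      simp only [Function.comp_apply]
      rw [h3]
      have h4 : 0 ≤ gDerivZero * (M ^ 2 - 1) ^ (-(2 / 3) : ℝ) :=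
        mul_nonneg gDerivZero_pos.le (Real.rpow_nonneg hu0.le _)
      calc _ ≤ gDerivZero * (M ^ 2 - 1) ^ (-(2 / 3) : ℝ) *
            (2 * (M ^ 2 - 1) ^ (1 / 2 : ℝ)) := mul_le_mul_of_nonneg_left h2 h4
        _ = _ := by ring
  have hdiff : Tendsto (fun z : ℂ => g z - g ((max z.re z.im : ℝ) * (1 + I)))
      (Bornology.cobounded ℂ ⊓ 𝓟 Quad) (𝓝 0) := by
    refine squeeze_zero_norm' ?_ (hdecay.comp hM)
    filter_upwards [mem_inf_of_right (mem_principal_self Quad), hM.eventually_gt_atTop 1]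
      with z hz hz1
    exact norm_g_sub_diagonal_le hz hz1
  simpa using hdiff.add (tendsto_g_diagonal.comp hM)

/-- The functional `√3 * re + im`, equal to `√3` on the side of the triangle from `1` to `i√3`. -/
noncomputable def slantCLM : ℂ →L[ℝ] ℝ := Real.sqrt 3 • reCLM + imCLM

lemma slantCLM_apply (z : ℂ) : slantCLM z = Real.sqrt 3 * z.re + z.im := by
  simp [slantCLM]

lemma slantCLM_I_mul_sqrt_three : slantCLM (I * Real.sqrt 3) = Real.sqrt 3 := by
  simp [slantCLM_apply]

lemma convexHull_triangle :
    convexHull ℝ ({0, 1, I * Real.sqrt 3} : Set ℂ) =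
      ({z | 0 ≤ z.re} ∩ {z | 0 ≤ z.im}) ∩ {z | slantCLM z ≤ Real.sqrt 3} := by
  have h3 : 0 < Real.sqrt 3 := by positivity
  refine Subset.antisymm (convexHull_min ?_ ?_) ?_
  · rintro z (rfl | rfl | rfl) <;> simp [slantCLM_apply]
  · exact ((convex_halfSpace_re_ge 0).inter (convex_halfSpace_im_ge 0)).inter
      (convex_halfSpace_le slantCLM.isLinear _)
  · rintro z ⟨⟨hre, him⟩, hs⟩
    simp only [mem_ofPred_eq, slantCLM_apply] at hre him hs
    have hy : z.im / Real.sqrt 3 * Real.sqrt 3 = z.im := div_mul_cancel₀ _ h3.ne'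
    have hy0 : 0 ≤ z.im / Real.sqrt 3 := by positivity
    have hsum : z.re + z.im / Real.sqrt 3 ≤ 1 := by
      rw [← mul_le_mul_iff_of_pos_right h3, add_mul, hy]
      linarith
    have hz : z = (1 - z.re - z.im / Real.sqrt 3) • (0 : ℂ) + z.re • (1 : ℂ) +
        (z.im / Real.sqrt 3) • (I * Real.sqrt 3) := by
      apply Complex.ext <;> simp [hy]
    rw [hz]
    have hmem : ∀ w ∈ ({0, 1, I * Real.sqrt 3} : Set ℂ),
      w ∈ convexHull ℝ ({0, 1, I * Real.sqrt 3} : Set ℂ) := subset_convexHull _ _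
    have := (convex_convexHull ℝ ({0, 1, I * Real.sqrt 3} : Set ℂ)).sum_mem
      (t := Finset.univ) (w := ![1 - z.re - z.im / Real.sqrt 3, z.re, z.im / Real.sqrt 3])
      (z := ![0, 1, I * Real.sqrt 3]) (by
        intro i _
        fin_cases i
        · simp; linarith
        · simpa using hre
        · simpa using hy0) (by simp [Fin.sum_univ_three]; ring) (by
        intro i _
        fin_cases i <;> exact hmem _ (by simp))
    simpa [Fin.sum_univ_three] using this

lemma interior_triangle_subset :
    interior (convexHull ℝ ({0, 1, I * Real.sqrt 3} : Set ℂ)) ⊆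
      Quad ∩ {z | slantCLM z < Real.sqrt 3} := by
  have hsurj : Function.Surjective slantCLM := fun y => ⟨y * I, by simp [slantCLM_apply]⟩
  have h : interior {z | slantCLM z ≤ Real.sqrt 3} = {z | slantCLM z < Real.sqrt 3} := by
    have := slantCLM.interior_preimage hsurj (Iic (Real.sqrt 3))
    rw [interior_Iic] at this
    exact this
  rw [convexHull_triangle, interior_inter, interior_inter, h, interior_setOfPred_le_re,
    interior_setOfPred_le_im]
  rfl

/-- The derivative of `√3 * re g + im g` in horizontal directions. -/
noncomputable def slantDeriv (z : ℂ) : ℝ :=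
  gDerivZero * (2 * (‖z ^ 2 - 1‖ ^ (-(2 / 3) : ℝ) * Real.sin (2 / 3 * arg (z ^ 2 - 1))))

lemma ofReal_add_mul_I_mem_Quad {s y : ℝ} (hs : 0 < s) (hy : 0 < y) : (s : ℂ) + y * I ∈ Quad := by
  simp [Quad, hs, hy]

lemma hasDerivAt_slantCLM_g {s y : ℝ} (hs : 0 < s) (hy : 0 < y) :
    HasDerivAt (fun s : ℝ => slantCLM (g (s + y * I))) (slantDeriv (s + y * I)) s := by
  have hq := ofReal_add_mul_I_mem_Quad hs hy
  have h1 := (((hasDerivAt_g (one_sub_sq_mem_slitPlane hq)).comp (s : ℂ)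
    ((hasDerivAt_id (s : ℂ)).add_const (y * I))).comp_ofReal)
  refine (slantCLM.hasFDerivAt.comp_hasDerivAt s h1).congr_deriv ?_
  rw [mul_one, slantCLM_apply, re_ofReal_mul, im_ofReal_mul, slantDeriv, ← neg_sub 1,
    ← sqrt_three_mul_cpow_re_add_im (one_sub_sq_im_neg hq)]
  ring

lemma slantDeriv_nonneg {z : ℂ} (hz : z ∈ Quad) : 0 ≤ slantDeriv z := by
  have him : 0 ≤ (z ^ 2 - 1).im := by
    have := one_sub_sq_im_neg hz
    rw [← neg_sub 1, neg_im]
    linarith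
  have h1 := arg_nonneg_iff.2 him
  have h2 := arg_le_pi (z ^ 2 - 1)
  have h3 := gDerivZero_pos
  have h4 : 0 ≤ Real.sin (2 / 3 * arg (z ^ 2 - 1)) :=
    Real.sin_nonneg_of_nonneg_of_le_pi (by linarith) (by linarith)
  rw [slantDeriv]
  positivity

lemma integral_slantDeriv {z : ℂ} (hz : z ∈ Quad) :
    ∫ s in Ioi z.re, slantDeriv (s + z.im * I) = Real.sqrt 3 - slantCLM (g z) := by
  have hpos : ∀ s ∈ Ici z.re, 0 < s := fun s hs => lt_of_lt_of_le hz.1 hs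
  have hlim : Tendsto (fun s : ℝ => slantCLM (g (s + z.im * I))) atTop (𝓝 (Real.sqrt 3)) := by
    have h1 : Tendsto (fun s : ℝ => (s : ℂ) + z.im * I) atTop
        (Bornology.cobounded ℂ ⊓ 𝓟 Quad) := by
      refine tendsto_inf.2 ⟨?_, tendsto_principal.2 ?_⟩
      · refine tendsto_norm_atTop_iff_cobounded.1 (tendsto_atTop_mono (fun s => ?_) tendsto_id)
        refine le_trans ?_ (re_le_norm _)
        simp
      · filter_upwards [eventually_gt_atTop 0] with s hs
        exact ofReal_add_mul_I_mem_Quad hs hz.2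
    have h2 := (slantCLM.continuous.tendsto _).comp (tendsto_g_cobounded.comp h1)
    rw [slantCLM_I_mul_sqrt_three] at h2
    exact h2
  have h := integral_Ioi_of_hasDerivAt_of_nonneg'
    (fun s hs => hasDerivAt_slantCLM_g (hpos s hs) hz.2)
    (fun s hs => slantDeriv_nonneg (ofReal_add_mul_I_mem_Quad (hpos s (Ioi_subset_Ici_self hs))
      hz.2)) hlim
  rwa [re_add_im] at h

lemma slantCLM_g_le {z : ℂ} (hz : z ∈ Quad) : slantCLM (g z) ≤ Real.sqrt 3 := by
  have h := setIntegral_nonneg (μ := volume) measurableSet_Ioi fun s (hs : s ∈ Ioi z.re) =>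
    slantDeriv_nonneg (ofReal_add_mul_I_mem_Quad (hz.1.trans hs) hz.2)
  rw [integral_slantDeriv hz] at h
  linarith

lemma image_g_Quad_subset :
    g '' Quad ⊆ interior (convexHull ℝ ({0, 1, I * Real.sqrt 3} : Set ℂ)) := by
  refine interior_maximal ?_ isOpen_image_g_Quad
  rw [convexHull_triangle]
  rintro _ ⟨z, hz, rfl⟩
  exact ⟨⟨g_re_nonneg hz, g_im_nonneg hz⟩, slantCLM_g_le hz⟩

lemma norm_slantDeriv_le {s y : ℝ} (hs : 0 < s) (hs1 : s ≠ 1) :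
    ‖slantDeriv (s + y * I)‖ ≤ gDerivZero * (2 * (|s - 1| * (s + 1)) ^ (-(2 / 3) : ℝ)) := by
  have hpos : 0 < |s - 1| * (s + 1) := mul_pos (abs_pos.2 (sub_ne_zero.2 hs1)) (by linarith)
  have hnorm : |s - 1| * (s + 1) ≤ ‖((s : ℂ) + y * I) ^ 2 - 1‖ := by
    rw [show ((s : ℂ) + y * I) ^ 2 - 1 = (s + y * I - 1) * (s + y * I + 1) by ring, norm_mul]
    refine mul_le_mul ?_ ?_ (by linarith) (norm_nonneg _)
    · simpa using abs_re_le_norm ((s : ℂ) + y * I - 1)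
    · simpa using re_le_norm ((s : ℂ) + y * I + 1)
  have hle := Real.rpow_le_rpow_of_nonpos hpos hnorm (show -(2 / 3) ≤ (0 : ℝ) by norm_num)
  rw [slantDeriv, norm_mul, norm_mul, norm_mul, Real.norm_of_nonneg gDerivZero_pos.le,
    Real.norm_of_nonneg (Real.rpow_nonneg (norm_nonneg _) _), Real.norm_ofNat]
  refine mul_le_mul_of_nonneg_left (mul_le_mul_of_nonneg_left ?_ two_pos.le) gDerivZero_pos.le
  refine (mul_le_of_le_one_right (Real.rpow_nonneg (norm_nonneg _) _) ?_).trans hle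
  exact Real.abs_sin_le_one _

lemma integrableOn_slantDeriv_bound :
    IntegrableOn (fun s : ℝ => (|s - 1| * (s + 1)) ^ (-(2 / 3) : ℝ)) (Ioi 0) := by
  have hmeas : Measurable fun s : ℝ => (|s - 1| * (s + 1)) ^ (-(2 / 3) : ℝ) := by fun_prop
  rw [← Ioc_union_Ioi_eq_Ioi (show (0 : ℝ) ≤ 2 by norm_num)]
  refine IntegrableOn.union ?_ ?_
  · have h1 : IntegrableOn (fun s : ℝ => |s - 1| ^ (-(2 / 3) : ℝ)) (Ioc 0 2) := by
      rw [← Ioc_union_Ioc_eq_Ioc (show (0 : ℝ) ≤ 1 by norm_num) one_le_two]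
      have h := intervalIntegral.intervalIntegrable_rpow' (a := 0) (b := 1)
        (show -1 < (-(2 / 3) : ℝ) by norm_num)
      refine IntegrableOn.union ?_ ?_
      · have h2 := (h.comp_sub_left 1).symm
        rw [sub_zero, sub_self, intervalIntegrable_iff_integrableOn_Ioc_of_le zero_le_one] at h2
        refine h2.congr_fun (fun s hs => ?_) measurableSet_Ioc
        simp only
        rw [abs_sub_comm, abs_of_nonneg (sub_nonneg.2 hs.2)]
      · have h2 := h.comp_sub_right 1
        rw [zero_add, one_add_one_eq_two,
          intervalIntegrable_iff_integrableOn_Ioc_of_le one_le_two] at h2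
        refine h2.congr_fun (fun s hs => ?_) measurableSet_Ioc
        simp only
        rw [abs_of_nonneg (sub_nonneg.2 hs.1.le)]
    refine h1.mono' hmeas.aestronglyMeasurable ?_
    refine (ae_restrict_iff' measurableSet_Ioc).2 (Eventually.of_forall fun s hs => ?_)
    have h0 : 0 < s + 1 := by linarith [hs.1]
    rw [Real.norm_of_nonneg (Real.rpow_nonneg (by positivity) _),
      Real.mul_rpow (abs_nonneg _) h0.le]
    exact mul_le_of_le_one_right (Real.rpow_nonneg (abs_nonneg _) _)
      (Real.rpow_le_one_of_one_le_of_nonpos (by linarith [hs.1]) (by norm_num))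
  · have h1 := integrableOn_add_rpow_Ioi_of_lt (m := -1) (c := 2)
      (show (-(4 / 3) : ℝ) < -1 by norm_num) (by norm_num)
    refine h1.mono' hmeas.aestronglyMeasurable ?_
    refine (ae_restrict_iff' measurableSet_Ioi).2 (Eventually.of_forall fun s (hs : 2 < s) => ?_)
    have h0 : 0 < s - 1 := by linarith
    have h2 : 0 < s + 1 := by linarith
    rw [Real.norm_of_nonneg (Real.rpow_nonneg (by positivity) _), abs_of_pos h0,
      ← sub_eq_add_neg, show (-(4 / 3) : ℝ) = 2 * -(2 / 3) by norm_num,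
      Real.rpow_mul h0.le, Real.rpow_two]
    exact Real.rpow_le_rpow_of_nonpos (by positivity) (by nlinarith) (by norm_num)

lemma measurable_slantDeriv : Measurable slantDeriv := by
  unfold slantDeriv
  fun_prop

lemma tendsto_slantDeriv {s x : ℝ} (hs : 1 < s) :
    Tendsto (fun z : ℂ => slantDeriv (s + z.im * I)) (𝓝 x) (𝓝 0) := by
  have hpos : 0 < s ^ 2 - 1 := by nlinarith
  have hslit : (s : ℂ) ^ 2 - 1 = ((s ^ 2 - 1 : ℝ) : ℂ) := by push_cast; rfl
  have h0 : slantDeriv s = 0 := by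
    rw [slantDeriv, hslit, arg_ofReal_of_nonneg hpos.le]
    simp
  have hc : ContinuousAt slantDeriv s := by
    have h1 : ContinuousAt (fun z : ℂ => z ^ 2 - 1) s := by fun_prop
    have h2 : ContinuousAt (fun z : ℂ => arg (z ^ 2 - 1)) s :=
      (continuousAt_arg (by rw [hslit]; exact ofReal_mem_slitPlane.2 hpos)).comp' h1
    refine continuousAt_const.mul (continuousAt_const.mul (ContinuousAt.mul ?_ ?_))
    · refine h1.norm.rpow_const (Or.inl ?_)
      rw [hslit]
      exact norm_ne_zero_iff.2 (ofReal_ne_zero.2 hpos.ne')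
    · exact Real.continuous_sin.continuousAt.comp' (continuousAt_const.mul h2)
  have h3 : Tendsto (fun z : ℂ => (s : ℂ) + z.im * I) (𝓝 x) (𝓝 s) := by
    have : Continuous fun z : ℂ => (s : ℂ) + z.im * I := by fun_prop
    simpa using this.tendsto (x : ℂ)
  rw [← h0]
  exact hc.tendsto.comp h3

lemma tendsto_slantCLM_g_nhdsWithin {x : ℝ} (hx : 1 ≤ x) :
    Tendsto (fun z => slantCLM (g z)) (𝓝[Quad] (x : ℂ)) (𝓝 (Real.sqrt 3)) := by
  have hint : Tendsto (fun z : ℂ => ∫ s in Ioi (0 : ℝ),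
      (Ioi z.re).indicator (fun s : ℝ => slantDeriv (s + z.im * I)) s) (𝓝[Quad] (x : ℂ))
      (𝓝 (∫ _ in Ioi (0 : ℝ), (0 : ℝ))) := by
    have hne : ∀ᵐ s : ℝ, s ≠ 1 := by simp [ae_iff]
    refine tendsto_integral_filter_of_dominated_convergence _ ?_ ?_
      ((integrableOn_slantDeriv_bound.const_mul 2).const_mul gDerivZero) ?_
    · refine Eventually.of_forall fun z => ?_
      exact ((measurable_slantDeriv.comp (by fun_prop :
        Measurable fun s : ℝ => (s : ℂ) + z.im * I)).indicator
          measurableSet_Ioi).aestronglyMeasurable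
    · refine Eventually.of_forall fun z => ?_
      filter_upwards [ae_restrict_mem measurableSet_Ioi, ae_restrict_of_ae hne] with s hs hs1
      exact (norm_indicator_le_norm_self _ _).trans (norm_slantDeriv_le hs hs1)
    · filter_upwards [ae_restrict_of_ae hne] with s hs1
      rcases lt_or_gt_of_ne hs1 with hs | hs
      · refine tendsto_const_nhds.congr' ?_
        have h1 : ∀ᶠ z : ℂ in 𝓝 (x : ℂ), s < z.re :=
          continuous_re.continuousAt.eventually_const_lt (by simpa using hs.trans_le hx)
        filter_upwards [nhdsWithin_le_nhds h1] with z hz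
        rw [indicator_of_notMem]
        exact fun h => lt_asymm hz h
      · refine squeeze_zero_norm (fun z => norm_indicator_le_norm_self _ _) ?_
        simpa using ((tendsto_slantDeriv (x := x) hs).mono_left nhdsWithin_le_nhds).norm
  rw [integral_zero] at hint
  have h1 := hint.const_sub (Real.sqrt 3)
  rw [sub_zero] at h1
  refine h1.congr' ?_
  filter_upwards [self_mem_nhdsWithin] with z hz
  rw [setIntegral_indicator measurableSet_Ioi, Ioi_inter_Ioi, sup_eq_right.2 hz.1.le,
    integral_slantDeriv hz]
  ring

lemma slantCLM_le_of_mem_closure {z : ℂ} (hz : z ∈ closure Quad) (hz' : 1 - z ^ 2 ∈ slitPlane) :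
    slantCLM (g z) ≤ Real.sqrt 3 := by
  have : (𝓝[Quad] z).NeBot := mem_closure_iff_nhdsWithin_neBot.1 hz
  have h1 : Tendsto (fun w => slantCLM (g w)) (𝓝[Quad] z) (𝓝 (slantCLM (g z))) :=
    (slantCLM.continuous.tendsto _).comp
      ((hasDerivAt_g hz').continuousAt.tendsto.mono_left nhdsWithin_le_nhds)
  refine le_of_tendsto h1 ?_
  filter_upwards [self_mem_nhdsWithin] with w hw
  exact slantCLM_g_le hw

lemma closure_Quad : closure Quad = {z | 0 ≤ z.re ∧ 0 ≤ z.im} := by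
  have : Quad = Ioi 0 ×ℂ Ioi 0 := rfl
  rw [this, closure_reProdIm, closure_Ioi]
  rfl

lemma g_ofReal_re_mem_Ioo {x : ℝ} (h0 : 0 < x) (h1 : x < 1) : (g x).re ∈ Ioo (0 : ℝ) 1 := by
  have hx : x ∈ Ioo (-1 : ℝ) 1 := ⟨by linarith, h1⟩
  have hx' : (x + 1) / 2 ∈ Ioo (-1 : ℝ) 1 := ⟨by linarith, by linarith⟩
  constructor
  · have := strictMonoOn_g_ofReal_re (show (0 : ℝ) ∈ Ioo (-1 : ℝ) 1 by norm_num) hx h0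
    simpa [g_zero] using this
  · have h2 := strictMonoOn_g_ofReal_re hx hx' (by linarith)
    have h3 := slantCLM_le_of_mem_closure (z := (((x + 1) / 2 : ℝ) : ℂ))
      (by rw [closure_Quad]; exact ⟨by rw [ofReal_re]; linarith, by rw [ofReal_im]⟩)
      (one_sub_ofReal_sq_mem_slitPlane hx')
    rw [slantCLM_apply, g_ofReal_im hx', add_zero] at h3
    exact h2.trans_le (by simpa using h3)

lemma g_I_mul_im_mem_Ioo {t : ℝ} (ht : 0 < t) : (g (I * t)).im ∈ Ioo (0 : ℝ) (Real.sqrt 3) := by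
  constructor
  · simpa [g_zero] using strictMono_g_I_mul_im ht
  · have h3 := slantCLM_le_of_mem_closure (z := I * (t + 1 : ℝ))
      (by rw [closure_Quad]; exact ⟨by simp, by simp; linarith⟩)
      (one_sub_I_mul_sq_mem_slitPlane _)
    rw [slantCLM_apply, g_I_mul_re, mul_zero, zero_add] at h3
    exact (strictMono_g_I_mul_im (lt_add_one t)).trans_le h3

lemma subset_image_g_Quad :
    interior (convexHull ℝ ({0, 1, I * Real.sqrt 3} : Set ℂ)) ⊆ g '' Quad := by
  have hconn := (convex_convexHull ℝ
    ({0, 1, I * Real.sqrt 3} : Set ℂ)).interior.isPreconnected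
  have hone : 1 + I ∈ Quad := by simp [Quad]
  refine hconn.subset_of_closure_inter_subset isOpen_image_g_Quad
    ⟨g (1 + I), image_g_Quad_subset (mem_image_of_mem g hone), mem_image_of_mem g hone⟩ ?_
  rintro w ⟨hw, hwT⟩
  obtain ⟨⟨hwre, hwim⟩, hws⟩ := interior_triangle_subset hwT
  obtain ⟨V, hV, hVw⟩ := mem_closure_iff_ultrafilter.1 hw
  set U := Ultrafilter.ofComapInfPrincipal hV
  have hUQ : (U : Filter ℂ) ≤ 𝓟 Quad :=
    le_principal_iff.2 (Ultrafilter.ofComapInfPrincipal_mem hV)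
  have hUg : Tendsto g U (𝓝 w) := by
    rw [Tendsto, ← Ultrafilter.coe_map, Ultrafilter.ofComapInfPrincipal_eq_of_map hV]
    exact hVw
  have hslant : ¬ Tendsto (fun z => slantCLM (g z)) U (𝓝 (Real.sqrt 3)) := fun h =>
    hws.ne (tendsto_nhds_unique ((slantCLM.continuous.tendsto w).comp hUg) h)
  by_cases hcob : (U : Filter ℂ) ≤ Bornology.cobounded ℂ
  · refine (hslant ?_).elim
    have h := (slantCLM.continuous.tendsto _).comp
      (tendsto_g_cobounded.mono_left (le_inf hcob hUQ))
    rwa [slantCLM_I_mul_sqrt_three] at h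
  obtain ⟨s, hs, hsU⟩ := not_forall₂.1 hcob
  have hbdd : Bornology.IsBounded sᶜ := Bornology.isBounded_def.2 (by rwa [compl_compl])
  obtain ⟨z, -, hUz⟩ := hbdd.isCompact_closure.ultrafilter_le_nhds' U
    (mem_of_superset (Ultrafilter.compl_mem_iff_notMem.2 hsU) subset_closure)
  have hUz' : (U : Filter ℂ) ≤ 𝓝[Quad] z := le_inf hUz hUQ
  have hzQ : z ∈ closure Quad := mem_closure_iff_nhdsWithin_neBot.2 (U.neBot.mono hUz')
  have hlim : 1 - z ^ 2 ∈ slitPlane → g z = w := fun h =>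
    tendsto_nhds_unique ((hasDerivAt_g h).continuousAt.tendsto.mono_left hUz) hUg
  rw [closure_Quad] at hzQ
  obtain ⟨hre, him⟩ := hzQ
  rcases hre.eq_or_lt with hre | hre
  · have hz : z = I * z.im := by apply Complex.ext <;> simp [← hre]
    have h := hlim (by rw [hz]; exact one_sub_I_mul_sq_mem_slitPlane _)
    rw [← h, hz, g_I_mul_re] at hwre
    exact (lt_irrefl _ hwre).elim
  rcases him.eq_or_lt with him | him
  · have hz : z = z.re := by apply Complex.ext <;> simp [← him]
    rcases lt_or_ge z.re 1 with h1 | h1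
    · have hx : z.re ∈ Ioo (-1 : ℝ) 1 := ⟨by linarith, h1⟩
      have h := hlim (by rw [hz]; exact one_sub_ofReal_sq_mem_slitPlane hx)
      rw [← h, hz, g_ofReal_im hx] at hwim
      exact (lt_irrefl _ hwim).elim
    · rw [hz] at hUz'
      exact (hslant ((tendsto_slantCLM_g_nhdsWithin h1).mono_left hUz')).elim
  · exact ⟨z, ⟨hre, him⟩, hlim (one_sub_sq_mem_slitPlane ⟨hre, him⟩)⟩

theorem stmt_6 :
    DifferentiableOn ℂ g Quad ∧
    Set.BijOn g Quad
      (interior (convexHull ℝ ({0, 1, Complex.I * Real.sqrt 3} : Set ℂ))) ∧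
    (∀ x : ℝ, 0 < x → x < 1 → (g x).im = 0 ∧ (g x).re ∈ Set.Ioo (0 : ℝ) 1) ∧
    (∀ t : ℝ, 0 < t →
      (g (Complex.I * t)).re = 0 ∧
      (g (Complex.I * t)).im ∈ Set.Ioo (0 : ℝ) (Real.sqrt 3)) := by
  refine ⟨fun z hz => ?_, ⟨mapsTo_iff_image_subset.2 image_g_Quad_subset, injOn_g_Quad,
    subset_image_g_Quad⟩,
    fun x h0 h1 => ⟨g_ofReal_im ⟨by linarith, h1⟩, g_ofReal_re_mem_Ioo h0 h1⟩,
    fun t ht => ⟨g_I_mul_re t, g_I_mul_im_mem_Ioo ht⟩⟩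
  exact (hasDerivAt_g (one_sub_sq_mem_slitPlane hz)).differentiableAt.differentiableWithinAt
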